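/- arXiv:2510.02948 — 2 statements merged into one kernel-verified Lean document; each statement's English description precedes it below -/
import Mathlib

section
/- Let Q be a symmetric n×n real matrix with at least one negative eigenvalue, d ∈ ℝⁿ, A ∈ ℝ^{m×n}, b ∈ ℝᵐ, and suppose F = {x : Ax ≤ b} is bounded. Let x̄ be a KKT point of the QP such that pᵀQp > 0 for every nonzero p with a_iᵀp = 0 for all i ∈ I_{x̄}. Let ν_R ≤ Φ(x̄) and β ∈ [0, Φ(x̄) − ν_R], and assume that either x̄ is nondegenerate or β > 0. Then there exist a positive semidefinite S ∈ 𝒮^{n+1}, an entrywise nonnegative T ∈ ℝ^{(m+1)×(m+1)} and c ∈ ℝⁿ such that [Q, d; dᵀ, −ν_R] = S + B₁ᵀ T B₁ + ½ u vᵀ + ½ v uᵀ, where B₁ = [−A, b; 0ᵀ, 1] ∈ ℝ^{(m+1)×(n+1)}, u = (Qx̄ + d; −x̄ᵀQx̄ − dᵀx̄ + β) and v = (−c; 1 + cᵀx̄). -/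
open Matrix

/-- The objective `Φ(x) = xᵀQx + 2dᵀx`. -/
noncomputable def Phi {n : ℕ} (Q : Matrix (Fin n) (Fin n) ℝ) (d : Fin n → ℝ)
    (x : Fin n → ℝ) : ℝ :=
  x ⬝ᵥ (Q *ᵥ x) + 2 * (d ⬝ᵥ x)

/-- The `(n+1) × (n+1)` symmetric matrix `[Q, d; dᵀ, −ν]`. -/
noncomputable def objMat {n : ℕ} (Q : Matrix (Fin n) (Fin n) ℝ) (d : Fin n → ℝ)
    (ν : ℝ) : Matrix (Fin n ⊕ Unit) (Fin n ⊕ Unit) ℝ :=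
  Matrix.of fun i j =>
    match i, j with
    | Sum.inl i, Sum.inl j => Q i j
    | Sum.inl i, Sum.inr _ => d i
    | Sum.inr _, Sum.inl j => d j
    | Sum.inr _, Sum.inr _ => -ν

/-- The `(m+1) × (n+1)` block matrix `B₁ = [−A, b; 0ᵀ, 1]`. -/
noncomputable def feasMat {n m : ℕ} (A : Matrix (Fin m) (Fin n) ℝ) (b : Fin m → ℝ) :
    Matrix (Fin m ⊕ Unit) (Fin n ⊕ Unit) ℝ :=
  Matrix.of fun i j =>
    match i, j with
    | Sum.inl i, Sum.inl j => -A i j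
    | Sum.inl i, Sum.inr _ => b i
    | Sum.inr _, Sum.inl _ => 0
    | Sum.inr _, Sum.inr _ => 1

/-- The vector `u = (Qx̄ + d; −x̄ᵀQx̄ − dᵀx̄ + β) ∈ ℝ^{n+1}`. -/
noncomputable def uVec {n : ℕ} (Q : Matrix (Fin n) (Fin n) ℝ) (d xbar : Fin n → ℝ)
    (β : ℝ) : Fin n ⊕ Unit → ℝ :=
  Sum.elim (Q *ᵥ xbar + d) (fun _ => -(xbar ⬝ᵥ (Q *ᵥ xbar)) - d ⬝ᵥ xbar + β)

/-- The vector `v = (−c; 1 + cᵀx̄) ∈ ℝ^{n+1}`. -/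
noncomputable def vVec {n : ℕ} (c xbar : Fin n → ℝ) : Fin n ⊕ Unit → ℝ :=
  Sum.elim (-c) (fun _ => 1 + c ⬝ᵥ xbar)

/-- `x̄` is a nondegenerate KKT point: there is a multiplier `λ̄` satisfying the KKT
conditions with `rank(A_{I_x̄}) = rank(A_{J_λ̄}) = |J_λ̄|` (the rows of `A` indexed by
`J_λ̄` are linearly independent and the rows indexed by `I_x̄` span a space of
dimension `|J_λ̄|`). -/
def NondegenerateKKT {n m : ℕ} (Q : Matrix (Fin n) (Fin n) ℝ) (d : Fin n → ℝ)
    (A : Matrix (Fin m) (Fin n) ℝ) (b : Fin m → ℝ) (xbar : Fin n → ℝ) : Prop :=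
  A *ᵥ xbar ≤ b ∧ ∃ lam : Fin m → ℝ, 0 ≤ lam ∧
    Q *ᵥ xbar + d = -(Aᵀ *ᵥ lam) ∧ (A *ᵥ xbar - b) ⬝ᵥ lam = 0 ∧
    Module.finrank ℝ
        (Submodule.span ℝ ((fun i => A i) '' {i : Fin m | (A *ᵥ xbar) i = b i})) =
      {i : Fin m | 0 < lam i}.ncard ∧
    LinearIndependent ℝ (fun i : {i : Fin m | 0 < lam i} => A i)

/-- Slack values in the coordinates `y = x - t x̄`. -/
noncomputable def wv {n m : ℕ} (A : Matrix (Fin m) (Fin n) ℝ) (b : Fin m → ℝ) (xbar : Fin n → ℝ)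
    (y : Fin n → ℝ) (t : ℝ) : Fin m ⊕ Unit → ℝ :=
  Sum.elim (fun i => (b i - (A *ᵥ xbar) i) * t - (A *ᵥ y) i) (fun _ => t)

/-- Nonnegative linear combinations of slacks. -/
def IsL {n m : ℕ} (A : Matrix (Fin m) (Fin n) ℝ) (b : Fin m → ℝ) (xbar : Fin n → ℝ)
    (f : (Fin n → ℝ) → ℝ → ℝ) : Prop :=
  ∃ μ : Fin m ⊕ Unit → ℝ, (∀ i, 0 ≤ μ i) ∧ ∀ y t, f y t = μ ⬝ᵥ wv A b xbar y t

/-- Nonnegative combinations of products of slacks. -/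
def IsT {n m : ℕ} (A : Matrix (Fin m) (Fin n) ℝ) (b : Fin m → ℝ) (xbar : Fin n → ℝ)
    (f : (Fin n → ℝ) → ℝ → ℝ) : Prop :=
  ∃ T : Matrix (Fin m ⊕ Unit) (Fin m ⊕ Unit) ℝ, (∀ i j, 0 ≤ T i j) ∧
    ∀ y t, f y t = wv A b xbar y t ⬝ᵥ (T *ᵥ wv A b xbar y t)

section closure
variable {n m : ℕ} {A : Matrix (Fin m) (Fin n) ℝ} {b : Fin m → ℝ} {xbar : Fin n → ℝ}
  {f g : (Fin n → ℝ) → ℝ → ℝ}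

lemma IsL.add (hf : IsL A b xbar f) (hg : IsL A b xbar g) :
    IsL A b xbar (fun y t => f y t + g y t) := by
  obtain ⟨μ, h1, h2⟩ := hf
  obtain ⟨μ', h1', h2'⟩ := hg
  exact ⟨μ + μ', fun i => add_nonneg (h1 i) (h1' i), fun y t => by
    simp only [h2, h2', add_dotProduct]⟩

lemma IsL.smul (hf : IsL A b xbar f) {r : ℝ} (hr : 0 ≤ r) :
    IsL A b xbar (fun y t => r * f y t) := by
  obtain ⟨μ, h1, h2⟩ := hf
  exact ⟨r • μ, fun i => mul_nonneg hr (h1 i), fun y t => by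
    simp only [h2, smul_dotProduct, smul_eq_mul]⟩

lemma IsL.zero : IsL A b xbar (fun _ _ => 0) := ⟨0, fun _ => le_rfl, fun y t => by simp⟩

lemma IsL.sum {ι : Type*} (s : Finset ι) (F : ι → (Fin n → ℝ) → ℝ → ℝ)
    (h : ∀ i ∈ s, IsL A b xbar (F i)) : IsL A b xbar (fun y t => ∑ i ∈ s, F i y t) := by
  classical
  induction s using Finset.induction_on with
  | empty => simpa using IsL.zero
  | insert a s ha ih =>
    simp only [Finset.sum_insert ha]
    exact (h a (by simp)).add (ih fun i hi => h i (by simp [hi]))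

lemma IsL.t : IsL A b xbar (fun _ t => t) := by
  classical
  exact ⟨Pi.single (Sum.inr ()) 1, fun i => by
    by_cases hi : i = Sum.inr () <;> simp [Pi.single_apply, hi], fun y t => by
    simp [wv]⟩

lemma IsL.slack (i : Fin m) :
    IsL A b xbar (fun y t => (b i - (A *ᵥ xbar) i) * t - (A *ᵥ y) i) := by
  classical
  refine ⟨Pi.single (Sum.inl i) 1, fun j => ?_, fun y t => by
    rw [single_dotProduct]; simp [wv]⟩
  rw [Pi.single_apply]; split_ifs <;> norm_num

lemma IsL.active {i : Fin m} (hi : (A *ᵥ xbar) i = b i) :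
    IsL A b xbar (fun y _ => -(A *ᵥ y) i) := by
  have := IsL.slack (A := A) (b := b) (xbar := xbar) i
  simpa [hi] using this

lemma IsT.add (hf : IsT A b xbar f) (hg : IsT A b xbar g) :
    IsT A b xbar (fun y t => f y t + g y t) := by
  obtain ⟨μ, h1, h2⟩ := hf
  obtain ⟨μ', h1', h2'⟩ := hg
  exact ⟨μ + μ', fun i j => add_nonneg (h1 i j) (h1' i j), fun y t => by
    simp only [h2, h2', add_mulVec, dotProduct_add]⟩

lemma IsT.zero : IsT A b xbar (fun _ _ => 0) := ⟨0, fun _ _ => le_rfl, fun y t => by simp⟩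

lemma IsT.sum {ι : Type*} (s : Finset ι) (F : ι → (Fin n → ℝ) → ℝ → ℝ)
    (h : ∀ i ∈ s, IsT A b xbar (F i)) : IsT A b xbar (fun y t => ∑ i ∈ s, F i y t) := by
  classical
  induction s using Finset.induction_on with
  | empty => simpa using IsT.zero
  | insert a s ha ih =>
    simp only [Finset.sum_insert ha]
    exact (h a (by simp)).add (ih fun i hi => h i (by simp [hi]))

lemma IsL.mul (hf : IsL A b xbar f) (hg : IsL A b xbar g) :
    IsT A b xbar (fun y t => f y t * g y t) := by
  obtain ⟨μ, h1, h2⟩ := hf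
  obtain ⟨μ', h1', h2'⟩ := hg
  refine ⟨vecMulVec μ μ', fun i j => mul_nonneg (h1 i) (h1' j), fun y t => ?_⟩
  simp only [h2, h2', vecMulVec_mulVec]
  simp [dotProduct_comm, mul_comm]

end closure

/-- Finsler type lemma. -/
lemma finsler {n : ℕ} {ι : Type*} (s : Finset ι) (q : (Fin n → ℝ) → ℝ) (hq : Continuous q)
    (hq2 : ∀ (r : ℝ) y, q (r • y) = r ^ 2 * q y) (l : ι → (Fin n → ℝ) → ℝ)
    (hl : ∀ i, Continuous (l i)) (hl2 : ∀ i (r : ℝ) y, l i (r • y) = r * l i y)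
    (hpos : ∀ y, y ≠ 0 → (∀ i ∈ s, l i y = 0) → 0 < q y) :
    ∃ K : ℝ, 0 ≤ K ∧ ∀ y, 0 ≤ q y + K * ∑ i ∈ s, (l i y) ^ 2 := by
  set h : (Fin n → ℝ) → ℝ := fun y => ∑ i ∈ s, (l i y) ^ 2 with hh
  have hc : Continuous h := by fun_prop
  have hnn : ∀ y, 0 ≤ h y := fun y => Finset.sum_nonneg fun i _ => sq_nonneg _
  suffices H : ∃ K : ℝ, 0 ≤ K ∧ ∀ y ∈ Metric.sphere (0 : Fin n → ℝ) 1, 0 ≤ q y + K * h y by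
    obtain ⟨K, hK, H⟩ := H
    refine ⟨K, hK, fun y => ?_⟩
    by_cases hy : y = 0
    · have : q y = 0 := by have := hq2 0 y; simp at this; rw [hy]; exact this
      rw [this]; have := mul_nonneg hK (hnn y); simpa using this
    · have h0 : ‖y‖ ≠ 0 := by simpa using hy
      have := H (‖y‖⁻¹ • y) (by simp [norm_smul, h0])
      have e : y = ‖y‖ • (‖y‖⁻¹ • y) := by rw [smul_smul, mul_inv_cancel₀ h0, one_smul]
      have e2 : h (‖y‖ • (‖y‖⁻¹ • y)) = ‖y‖ ^ 2 * h (‖y‖⁻¹ • y) := by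
        simp only [hh, hl2 _ ‖y‖, Finset.mul_sum, mul_pow]
      change 0 ≤ q y + K * h y
      rw [e, hq2 ‖y‖, e2]
      have := mul_nonneg (sq_nonneg ‖y‖) this
      linarith
  have hcomp : IsCompact (Metric.sphere (0 : Fin n → ℝ) 1 ∩ {y | q y ≤ 0}) :=
    (isCompact_sphere _ _).inter_right (isClosed_le hq continuous_const)
  rcases (Metric.sphere (0 : Fin n → ℝ) 1 ∩ {y | q y ≤ 0}).eq_empty_or_nonempty with he | hne
  · refine ⟨0, le_rfl, fun y hy => ?_⟩
    by_contra hcon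
    have : y ∈ Metric.sphere (0 : Fin n → ℝ) 1 ∩ {y | q y ≤ 0} := ⟨hy, by
      simp only [Set.mem_setOf_eq]; linarith⟩
    simp [he] at this
  · obtain ⟨y1, hy1, hm1⟩ := hcomp.exists_isMinOn hne hc.continuousOn
    obtain ⟨y2, hy2, hm2⟩ := hcomp.exists_isMinOn hne hq.continuousOn
    have hp : 0 < h y1 := by
      rcases (hnn y1).lt_or_eq with h' | h'
      · exact h'
      · exfalso
        have hz : ∀ i ∈ s, l i y1 = 0 := fun i hi => by
          have := (Finset.sum_eq_zero_iff_of_nonneg (fun i _ => sq_nonneg (l i y1))).1 h'.symm i hi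
          simpa using this
        have hne0 : y1 ≠ 0 := by
          rintro rfl
          simpa using hy1.1
        have h3 := hpos y1 hne0 hz
        have h4 : q y1 ≤ 0 := hy1.2
        linarith
    have hq2' : q y2 ≤ 0 := hy2.2
    have hK : 0 ≤ -q y2 / h y1 := div_nonneg (by linarith) hp.le
    refine ⟨-q y2 / h y1, hK, fun y hy => ?_⟩
    by_cases hqy : q y ≤ 0
    · have a1 : h y1 ≤ h y := hm1 ⟨hy, hqy⟩
      have a2 : q y2 ≤ q y := hm2 ⟨hy, hqy⟩
      have := mul_le_mul_of_nonneg_left a1 hK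
      rw [div_mul_cancel₀ _ hp.ne'] at this
      linarith
    · have := mul_nonneg hK (hnn y)
      linarith

/-- Stiemke type lemma via minimization of a sum of exponentials. -/
lemma stiemke {n m : ℕ} (A : Matrix (Fin m) (Fin n) ℝ)
    (h : ∀ y : Fin n → ℝ, A *ᵥ y ≤ 0 → y = 0) :
    ∃ μ : Fin m → ℝ, (∀ i, 0 < μ i) ∧ ∀ y, ∑ i, μ i * (A *ᵥ y) i = 0 := by
  have hAc : ∀ i, Continuous fun y : Fin n → ℝ => (A *ᵥ y) i := fun i => by
    simp only [mulVec, dotProduct]; fun_prop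
  set g : (Fin n → ℝ) → ℝ := fun y => ∑ i, max ((A *ᵥ y) i) 0 with hg
  have hgc : Continuous g := by fun_prop
  have hgpos : ∀ y, y ≠ 0 → 0 < g y := by
    intro y hy
    have : ∃ i, 0 < (A *ᵥ y) i := by
      by_contra hcon
      push Not at hcon
      exact hy (h y fun i => hcon i)
    obtain ⟨i, hi⟩ := this
    exact Finset.sum_pos' (fun i _ => le_max_right _ _) ⟨i, Finset.mem_univ _, lt_max_of_lt_left hi⟩
  have hlow : ∃ ε : ℝ, 0 < ε ∧ ∀ y, ε * ‖y‖ ≤ g y := by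
    rcases (Metric.sphere (0 : Fin n → ℝ) 1).eq_empty_or_nonempty with he | hne
    · refine ⟨1, one_pos, fun y => ?_⟩
      by_cases hy : y = 0
      · simp [hy, hg]
      · exfalso
        have h0 : ‖y‖ ≠ 0 := by simpa using hy
        have : ‖y‖⁻¹ • y ∈ Metric.sphere (0 : Fin n → ℝ) 1 := by simp [norm_smul, h0]
        simp [he] at this
    · obtain ⟨y1, hy1, hm⟩ := (isCompact_sphere (0 : Fin n → ℝ) 1).exists_isMinOn hne hgc.continuousOn
      refine ⟨g y1, hgpos y1 (by rintro rfl; simp at hy1), fun y => ?_⟩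
      by_cases hy : y = 0
      · simp [hy, hg]
      · have h0 : 0 < ‖y‖ := by simpa using hy
        have h1 : g y1 ≤ g (‖y‖⁻¹ • y) := hm (by simp [norm_smul, h0.ne'])
        have h2 : g y = ‖y‖ * g (‖y‖⁻¹ • y) := by
          simp only [hg, Finset.mul_sum, mulVec_smul, Pi.smul_apply, smul_eq_mul]
          refine Finset.sum_congr rfl fun i _ => ?_
          rw [mul_max_of_nonneg _ _ h0.le, mul_zero, ← mul_assoc, mul_inv_cancel₀ h0.ne', one_mul]
        rw [h2, mul_comm]
        exact mul_le_mul_of_nonneg_left h1 h0.le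
  obtain ⟨ε, hε, hlow⟩ := hlow
  set f : (Fin n → ℝ) → ℝ := fun y => ∑ i, Real.exp ((A *ᵥ y) i) with hf
  have hfc : Continuous f := by fun_prop
  have hfg : ∀ y, ε * ‖y‖ ≤ f y := fun y => (hlow y).trans <| Finset.sum_le_sum fun i _ =>
    max_le (by linarith [Real.add_one_le_exp ((A *ᵥ y) i)]) (Real.exp_pos _).le
  have hlim : Filter.Tendsto f (Filter.cocompact _) Filter.atTop :=
    Filter.tendsto_atTop_mono hfg ((tendsto_norm_cocompact_atTop).const_mul_atTop hε)
  obtain ⟨y0, hy0⟩ := hfc.exists_forall_le hlim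
  refine ⟨fun i => Real.exp ((A *ᵥ y0) i), fun i => Real.exp_pos _, fun y => ?_⟩
  have hd : HasDerivAt (fun s : ℝ => ∑ i, Real.exp ((A *ᵥ y0) i + s * (A *ᵥ y) i))
      (∑ i, Real.exp ((A *ᵥ y0) i + 0 * (A *ᵥ y) i) * (1 * (A *ᵥ y) i)) 0 := by
    refine HasDerivAt.fun_sum fun i _ => ?_
    exact (((hasDerivAt_id (0 : ℝ)).mul_const _).const_add _).exp
  have hmin : IsLocalMin (fun s : ℝ => ∑ i, Real.exp ((A *ᵥ y0) i + s * (A *ᵥ y) i)) 0 := by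
    refine Filter.Eventually.of_forall fun s => ?_
    have := hy0 (y0 + s • y)
    simpa [hf, mulVec_add, mulVec_smul] using this
  simpa using hmin.hasDerivAt_eq_zero hd

/-- Recession cone of a bounded nonempty polyhedron is trivial. -/
lemma recession {n m : ℕ} (A : Matrix (Fin m) (Fin n) ℝ) (b : Fin m → ℝ)
    (hbdd : Bornology.IsBounded {x : Fin n → ℝ | A *ᵥ x ≤ b})
    (xbar : Fin n → ℝ) (hfeas : A *ᵥ xbar ≤ b) (y : Fin n → ℝ) (hy : A *ᵥ y ≤ 0) : y = 0 := by
  by_contra hne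
  have h0 : 0 < ‖y‖ := by simpa using hne
  obtain ⟨R, hR⟩ := hbdd.exists_norm_le
  have hR0 : 0 ≤ R := (norm_nonneg _).trans (hR xbar hfeas)
  set s : ℝ := (2 * R + 1) / ‖y‖ with hs
  have hs0 : 0 ≤ s := by positivity
  have h1 := hR (xbar + s • y) (by
    intro i
    have h2 := mul_nonpos_of_nonneg_of_nonpos hs0 (hy i)
    have h3 := hfeas i
    simp only [mulVec_add, mulVec_smul, Pi.add_apply, Pi.smul_apply, smul_eq_mul]
    linarith)
  have h2 := hR xbar hfeas
  have h3 : ‖s • y‖ = 2 * R + 1 := by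
    rw [norm_smul, Real.norm_of_nonneg hs0, hs, div_mul_cancel₀ _ h0.ne']
  have h4 : ‖s • y‖ ≤ ‖xbar + s • y‖ + ‖xbar‖ := by
    have := norm_sub_le (xbar + s • y) xbar
    simpa using this
  linarith

lemma bound_slack {n m : ℕ} {A : Matrix (Fin m) (Fin n) ℝ} {b xb}
    (h : ∀ y : Fin n → ℝ, A *ᵥ y ≤ 0 → y = 0) (i : Fin m) (hi : (A *ᵥ xb) i = b i) :
    ∃ M : ℝ, 0 ≤ M ∧ IsL A b xb (fun y t => M * t - -(A *ᵥ y) i) := by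
  obtain ⟨μ, hμ, hs⟩ := stiemke A h
  set C : ℝ := ∑ j ∈ Finset.univ.erase i, μ j / μ i * (b j - (A *ᵥ xb) j) with hC
  have hL : IsL A b xb (fun y t => (∑ j ∈ Finset.univ.erase i,
      μ j / μ i * ((b j - (A *ᵥ xb) j) * t - (A *ᵥ y) j)) + (|C| - C) * t) :=
    (IsL.sum _ _ fun j _ => (IsL.slack j).smul (div_nonneg (hμ j).le (hμ i).le)).add
      (IsL.t.smul (by linarith [le_abs_self C]))
  refine ⟨|C|, abs_nonneg _, ?_⟩
  convert hL using 3 with y t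
  have h1 := hs y
  rw [← Finset.add_sum_erase _ _ (Finset.mem_univ i)] at h1
  have h2 : ∑ j ∈ Finset.univ.erase i, μ j / μ i * (A *ᵥ y) j = -(A *ᵥ y) i := by
    have h3 : ∑ j ∈ Finset.univ.erase i, μ j / μ i * (A *ᵥ y) j =
        (∑ j ∈ Finset.univ.erase i, μ j * (A *ᵥ y) j) / μ i := by
      rw [Finset.sum_div]; exact Finset.sum_congr rfl fun j _ => by ring
    rw [h3, div_eq_iff (hμ i).ne']; linarith
  have h4 : ∑ j ∈ Finset.univ.erase i,
      μ j / μ i * ((b j - (A *ᵥ xb) j) * t - (A *ᵥ y) j) = C * t - -(A *ᵥ y) i := by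
    rw [← h2, hC, Finset.sum_mul, ← Finset.sum_sub_distrib]
    exact Finset.sum_congr rfl fun j _ => by ring
  rw [h4]; ring

lemma reduction {n m : ℕ}
    (Q : Matrix (Fin n) (Fin n) ℝ) (hQ : Q.IsSymm)
    (d : Fin n → ℝ) (A : Matrix (Fin m) (Fin n) ℝ) (b : Fin m → ℝ)
    (xbar : Fin n → ℝ) (νR β : ℝ) (c : Fin n → ℝ) (f : (Fin n → ℝ) → ℝ → ℝ)
    (hf : IsT A b xbar f)
    (hnn : ∀ y t, 0 ≤ y ⬝ᵥ (Q *ᵥ y) + 2 * t * ((Q *ᵥ xbar + d) ⬝ᵥ y) + (Phi Q d xbar - νR) * t ^ 2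
      - f y t - ((Q *ᵥ xbar + d) ⬝ᵥ y + β * t) * (t - c ⬝ᵥ y)) :
    ∃ (S : Matrix (Fin n ⊕ Unit) (Fin n ⊕ Unit) ℝ)
      (T : Matrix (Fin m ⊕ Unit) (Fin m ⊕ Unit) ℝ) (c : Fin n → ℝ),
      S.PosSemidef ∧ (∀ i j, 0 ≤ T i j) ∧
      objMat Q d νR =
        S + (feasMat A b)ᵀ * T * feasMat A b +
          (1 / 2 : ℝ) • (vecMulVec (uVec Q d xbar β) (vVec c xbar)) +
          (1 / 2 : ℝ) • (vecMulVec (vVec c xbar) (uVec Q d xbar β)) := by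
  obtain ⟨T, hT, hfT⟩ := hf
  set B := feasMat A b with hB
  set u := uVec Q d xbar β with hu
  set v := vVec c xbar with hv
  set T' : Matrix (Fin m ⊕ Unit) (Fin m ⊕ Unit) ℝ := (1 / 2 : ℝ) • (T + Tᵀ) with hT'
  refine ⟨objMat Q d νR - Bᵀ * T' * B - (1 / 2 : ℝ) • vecMulVec u v - (1 / 2 : ℝ) • vecMulVec v u,
    T', c, ?_, ?_, ?_⟩
  · refine PosSemidef.of_dotProduct_mulVec_nonneg ?_ ?_
    · have ho : (objMat Q d νR)ᵀ = objMat Q d νR := by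
        ext i j
        rcases i with i | i <;> rcases j with j | j <;> simp [objMat, hQ.apply]
      have hTs : T'ᵀ = T' := by simp [hT', add_comm]
      rw [IsHermitian, conjTranspose_eq_transpose_of_trivial]
      simp only [transpose_sub, transpose_smul, transpose_mul, transpose_transpose, ho, hTs,
        transpose_vecMulVec, Matrix.mul_assoc]
      abel
    · intro z
      obtain ⟨y, t, rfl⟩ : ∃ (y : Fin n → ℝ) (t : ℝ), z = Sum.elim (y + t • xbar) (fun _ => t) := by
        refine ⟨z ∘ Sum.inl - z (Sum.inr ()) • xbar, z (Sum.inr ()), ?_⟩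
        ext i
        rcases i with i | i <;> simp
      set z : Fin n ⊕ Unit → ℝ := Sum.elim (y + t • xbar) (fun _ => t) with hz
      have hBz : B *ᵥ z = wv A b xbar y t := by
        ext i
        rcases i with i | i
        · have e : (B *ᵥ z) (Sum.inl i) = -(A *ᵥ (y + t • xbar)) i + b i * t := by
            simp [hB, hz, feasMat, mulVec, dotProduct, Finset.sum_neg_distrib]
          rw [e]
          simp only [wv, Sum.elim_inl, mulVec_add, mulVec_smul, Pi.add_apply, Pi.smul_apply,
            smul_eq_mul]
          ring
        · simp [hB, hz, feasMat, wv, mulVec, dotProduct]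
      have hoz : z ⬝ᵥ (objMat Q d νR *ᵥ z) = (y + t • xbar) ⬝ᵥ (Q *ᵥ (y + t • xbar))
          + 2 * t * (d ⬝ᵥ (y + t • xbar)) - νR * t ^ 2 := by
        have e : objMat Q d νR *ᵥ z = Sum.elim (Q *ᵥ (y + t • xbar) + t • d)
            (fun _ => d ⬝ᵥ (y + t • xbar) - νR * t) := by
          ext i
          rcases i with i | i
          · simp [hz, objMat, mulVec, dotProduct]; ring
          · simp [hz, objMat, mulVec, dotProduct]; ring
        rw [e, hz, sumElim_dotProduct_sumElim, dotProduct_add, dotProduct_smul,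
          dotProduct_comm _ d]
        simp [dotProduct]; ring
      have hsym : xbar ⬝ᵥ (Q *ᵥ y) = y ⬝ᵥ (Q *ᵥ xbar) := by
        rw [dotProduct_mulVec, ← mulVec_transpose, hQ.eq, dotProduct_comm]
      have huz : u ⬝ᵥ z = (Q *ᵥ xbar + d) ⬝ᵥ y + β * t := by
        rw [hu, hz, uVec, sumElim_dotProduct_sumElim, dotProduct_add, dotProduct_smul,
          add_dotProduct _ _ xbar, dotProduct_comm _ xbar]
        simp [dotProduct]; ring
      have hvz : v ⬝ᵥ z = t - c ⬝ᵥ y := by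
        rw [hv, hz, vVec, sumElim_dotProduct_sumElim, dotProduct_add, dotProduct_smul,
          neg_dotProduct, neg_dotProduct]
        simp [dotProduct]; ring
      have hTz : z ⬝ᵥ ((Bᵀ * T' * B) *ᵥ z) = f y t := by
        rw [hfT, ← mulVec_mulVec, ← mulVec_mulVec, hBz, dotProduct_mulVec, vecMul_transpose, hBz,
          hT', smul_mulVec, add_mulVec, dotProduct_smul, dotProduct_add, mulVec_transpose,
          dotProduct_comm _ (_ ᵥ* T), ← dotProduct_mulVec]
        simp; ring
      have key := hnn y t
      simp only [star_trivial, sub_mulVec, smul_mulVec, dotProduct_sub, dotProduct_smul,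
        vecMulVec_mulVec, hTz, hoz]
      simp only [op_smul_eq_smul, smul_eq_mul, dotProduct_comm z,
        huz, hvz]
      simp only [mulVec_add, mulVec_smul, dotProduct_add, add_dotProduct, dotProduct_smul,
        smul_dotProduct, smul_eq_mul, hsym, Phi] at key ⊢
      rw [dotProduct_comm (Q *ᵥ xbar) y] at key ⊢
      linarith
  · intro i j
    simp only [hT', Matrix.smul_apply, Matrix.add_apply, transpose_apply, smul_eq_mul]
    have := hT i j
    have := hT j i
    linarith
  · abel

/-- Theorem `thm:STc` (a). Let `Q` be symmetric with at least one
negative eigenvalue, `F` bounded, `x̄` a KKT point with `Q` positive definite on the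
null space of the active constraints, `ν_R ≤ Φ(x̄)`, `β ∈ [0, Φ(x̄) − ν_R]`, and
assume `x̄` is nondegenerate or `β > 0`. Then the cut-generating SDP is feasible:
there exist `S ⪰ 0`, `T ≥ 0` entrywise, and `c` with
`[Q, d; dᵀ, −ν_R] = S + B₁ᵀ T B₁ + ½uvᵀ + ½vuᵀ`. -/
theorem cut_SDP_feasible {n m : ℕ}
    (Q : Matrix (Fin n) (Fin n) ℝ) (hQ : Q.IsSymm)
    (hneg : ∃ μ : ℝ, μ < 0 ∧ ∃ v : Fin n → ℝ, v ≠ 0 ∧ Q *ᵥ v = μ • v)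
    (d : Fin n → ℝ) (A : Matrix (Fin m) (Fin n) ℝ) (b : Fin m → ℝ)
    (hbdd : Bornology.IsBounded {x : Fin n → ℝ | A *ᵥ x ≤ b})
    (xbar : Fin n → ℝ) (hfeas : A *ᵥ xbar ≤ b)
    (hKKT : ∃ lam : Fin m → ℝ, 0 ≤ lam ∧
      Q *ᵥ xbar + d = -(Aᵀ *ᵥ lam) ∧ (A *ᵥ xbar - b) ⬝ᵥ lam = 0)
    (hpd : ∀ p : Fin n → ℝ, p ≠ 0 →
      (∀ i : Fin m, (A *ᵥ xbar) i = b i → (A *ᵥ p) i = 0) → 0 < p ⬝ᵥ (Q *ᵥ p))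
    (νR β : ℝ) (hνR : νR ≤ Phi Q d xbar)
    (hβ0 : 0 ≤ β) (hβ1 : β ≤ Phi Q d xbar - νR)
    (hcase : NondegenerateKKT Q d A b xbar ∨ 0 < β) :
    ∃ (S : Matrix (Fin n ⊕ Unit) (Fin n ⊕ Unit) ℝ)
      (T : Matrix (Fin m ⊕ Unit) (Fin m ⊕ Unit) ℝ) (c : Fin n → ℝ),
      S.PosSemidef ∧ (∀ i j, 0 ≤ T i j) ∧
      objMat Q d νR =
        S + (feasMat A b)ᵀ * T * feasMat A b +
          (1 / 2 : ℝ) • (vecMulVec (uVec Q d xbar β) (vVec c xbar)) +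
          (1 / 2 : ℝ) • (vecMulVec (vVec c xbar) (uVec Q d xbar β)) := by
  have hQc : Continuous fun y : Fin n → ℝ => y ⬝ᵥ (Q *ᵥ y) := by
    simp only [mulVec, dotProduct]; fun_prop
  have hAc : ∀ i, Continuous fun y : Fin n → ℝ => (A *ᵥ y) i := fun i => by
    simp only [mulVec, dotProduct]; fun_prop
  have hcompl : ∀ lam : Fin m → ℝ, 0 ≤ lam → (A *ᵥ xbar - b) ⬝ᵥ lam = 0 →
      ∀ i, 0 < lam i → (A *ᵥ xbar) i = b i := by
    intro lam hl hc i hi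
    have h1 : ∀ j ∈ Finset.univ, (A *ᵥ xbar - b) j * lam j ≤ 0 := fun j _ =>
      mul_nonpos_of_nonpos_of_nonneg (by simpa using hfeas j) (hl j)
    have h2 := (Finset.sum_eq_zero_iff_of_nonpos h1).1 hc i (Finset.mem_univ i)
    rcases mul_eq_zero.1 h2 with h | h
    · simpa [sub_eq_zero] using h
    · linarith
  have hg : ∀ lam : Fin m → ℝ, 0 ≤ lam → Q *ᵥ xbar + d = -(Aᵀ *ᵥ lam) → ∀ y,
      (Q *ᵥ xbar + d) ⬝ᵥ y = ∑ i ∈ Finset.univ.filter (fun i => 0 < lam i),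
        lam i * -(A *ᵥ y) i := by
    intro lam hl he y
    rw [he, neg_dotProduct, mulVec_transpose, ← dotProduct_mulVec, Finset.sum_filter,
      dotProduct, ← Finset.sum_neg_distrib]
    refine Finset.sum_congr rfl fun i _ => ?_
    split_ifs with h
    · ring
    · have : lam i = 0 := le_antisymm (not_lt.1 h) (hl i)
      simp [this]
  have hδ : IsT A b xbar (fun _ t => (Phi Q d xbar - νR - β) * t * t) :=
    (IsL.t.smul (by linarith)).mul IsL.t
  rcases hcase with ⟨-, lam, hl, he, hc, hrank, hli⟩ | hβ
  · set J := Finset.univ.filter (fun i => 0 < lam i) with hJ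
    have hspan : Submodule.span ℝ ((fun i => A i) '' {i : Fin m | 0 < lam i}) =
        Submodule.span ℝ ((fun i => A i) '' {i : Fin m | (A *ᵥ xbar) i = b i}) := by
      refine Submodule.eq_of_le_of_finrank_eq
        (Submodule.span_mono (Set.image_mono fun i hi => hcompl lam hl hc i hi)) ?_
      rw [hrank, Set.image_eq_range, ← Nat.card_coe_set_eq, Nat.card_eq_fintype_card]
      exact finrank_span_eq_card hli
    have hnull : ∀ p : Fin n → ℝ, (∀ i ∈ J, (A *ᵥ p) i = 0) →
        ∀ i, (A *ᵥ xbar) i = b i → (A *ᵥ p) i = 0 := by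
      intro p hp i hi
      have hmem : A i ∈ Submodule.span ℝ ((fun i => A i) '' {i : Fin m | 0 < lam i}) := by
        rw [hspan]; exact Submodule.subset_span ⟨i, hi, rfl⟩
      have : ∀ a ∈ Submodule.span ℝ ((fun i => A i) '' {i : Fin m | 0 < lam i}),
          a ⬝ᵥ p = 0 := by
        intro a ha
        induction ha using Submodule.span_induction with
        | mem x hx =>
          obtain ⟨j, hj, rfl⟩ := hx
          exact hp j (by simpa [hJ] using hj)
        | zero => simp
        | add x y _ _ hx hy => rw [add_dotProduct, hx, hy, add_zero]
        | smul r x _ hx => rw [smul_dotProduct, hx, smul_zero]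
      exact this _ hmem
    obtain ⟨K, hK, hfin⟩ := finsler J (fun y => y ⬝ᵥ (Q *ᵥ y)) hQc
      (fun r y => by simp [mulVec_smul]; ring) (fun i y => (A *ᵥ y) i) hAc
      (fun i r y => by simp [mulVec_smul]) (fun y hy h => hpd y hy (hnull y h))
    have hJl : ∀ i ∈ J, 0 < lam i := fun i hi => by simpa [hJ] using hi
    have hact : ∀ i ∈ J, IsL A b xbar (fun y _ => -(A *ᵥ y) i) := fun i hi =>
      IsL.active (hcompl lam hl hc i (hJl i hi))
    have hact2 : ∀ i ∈ J, IsL A b xbar (fun y _ => K / lam i * -(A *ᵥ y) i) := fun i hi =>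
      (hact i hi).smul (div_nonneg hK (hJl i hi).le)
    have hT : IsT A b xbar (fun y t => (Phi Q d xbar - νR - β) * t * t +
        (β * t) * (∑ j ∈ J, K / lam j * -(A *ᵥ y) j) +
        ∑ i ∈ J, (lam i * -(A *ᵥ y) i) * (t + ∑ j ∈ J.erase i, K / lam j * -(A *ᵥ y) j)) :=
      (hδ.add ((IsL.t.smul hβ0).mul (IsL.sum J _ hact2))).add
        (IsT.sum J _ fun i hi => ((hact i hi).smul (hJl i hi).le).mul
          (IsL.t.add (IsL.sum (J.erase i) _ fun j hj => hact2 j (Finset.mem_of_mem_erase hj))))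
    refine reduction Q hQ d A b xbar νR β (∑ j ∈ J, (-(K / lam j)) • A j) _ hT fun y t => ?_
    have hcy : (∑ j ∈ J, (-(K / lam j)) • A j) ⬝ᵥ y = ∑ j ∈ J, K / lam j * -(A *ᵥ y) j := by
      rw [sum_dotProduct]
      refine Finset.sum_congr rfl fun j _ => ?_
      rw [smul_dotProduct, smul_eq_mul]
      change -(K / lam j) * (A *ᵥ y) j = _
      ring
    have hlast : ∑ i ∈ J, (lam i * -(A *ᵥ y) i) * (t + ∑ j ∈ J.erase i, K / lam j * -(A *ᵥ y) j)
        = (∑ i ∈ J, lam i * -(A *ᵥ y) i) * (t + ∑ j ∈ J, K / lam j * -(A *ᵥ y) j)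
          - K * ∑ i ∈ J, (A *ᵥ y) i ^ 2 := by
      rw [Finset.sum_mul, Finset.mul_sum, ← Finset.sum_sub_distrib]
      refine Finset.sum_congr rfl fun i hi => ?_
      rw [← Finset.add_sum_erase J _ hi]
      have := (hJl i hi).ne'
      field_simp
      ring
    have h0 := hfin y
    rw [hcy, hlast, hg lam hl he y]
    linarith
  · obtain ⟨lam, hl, he, hc⟩ := hKKT
    set I := Finset.univ.filter (fun i => (A *ᵥ xbar) i = b i) with hI
    have hIa : ∀ i ∈ I, (A *ᵥ xbar) i = b i := fun i hi => by simpa [hI] using hi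
    set J := Finset.univ.filter (fun i => 0 < lam i) with hJ
    have hJl : ∀ i ∈ J, 0 < lam i := fun i hi => by simpa [hJ] using hi
    have hrec := recession A b hbdd xbar hfeas
    have hM : ∀ i, ∃ M : ℝ, i ∈ I → 0 ≤ M ∧ IsL A b xbar (fun y t => M * t - -(A *ᵥ y) i) := by
      intro i
      by_cases hi : i ∈ I
      · obtain ⟨M, h⟩ := bound_slack (b := b) (xb := xbar) hrec i (hIa i hi)
        exact ⟨M, fun _ => h⟩
      · exact ⟨0, fun h => absurd h hi⟩
    choose M hM using hM
    have hgc : Continuous fun y : Fin n → ℝ => (Q *ᵥ xbar + d) ⬝ᵥ y := by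
      simp only [dotProduct]; fun_prop
    obtain ⟨K, hK, hfin⟩ := finsler I
      (fun y => y ⬝ᵥ (Q *ᵥ y) - ((Q *ᵥ xbar + d) ⬝ᵥ y) ^ 2 / β) (by fun_prop)
      (fun r y => by simp only [mulVec_smul, dotProduct_smul, smul_dotProduct, smul_eq_mul]; ring)
      (fun i y => (A *ᵥ y) i) hAc
      (fun i r y => by simp [mulVec_smul]) (fun y hy h => by
        have h1 := hpd y hy (fun i hi => h i (by simpa [hI] using hi))
        have h2 : (Q *ᵥ xbar + d) ⬝ᵥ y = 0 := by
          rw [hg lam hl he y]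
          refine Finset.sum_eq_zero fun i hi => ?_
          rw [h i (by simpa [hI] using hcompl lam hl hc i (hJl i hi))]; simp
        rw [h2]; simpa using h1)
    have hactJ : ∀ i ∈ J, IsL A b xbar (fun y _ => lam i * -(A *ᵥ y) i) := fun i hi =>
      (IsL.active (hcompl lam hl hc i (hJl i hi))).smul (hJl i hi).le
    have hact : ∀ i ∈ I, IsL A b xbar (fun y _ => -(A *ᵥ y) i) := fun i hi =>
      IsL.active (hIa i hi)
    have hactI : ∀ i ∈ I, IsL A b xbar (fun y _ => (K * M i) * -(A *ᵥ y) i) := fun i hi =>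
      (hact i hi).smul (mul_nonneg hK (hM i hi).1)
    have hT : IsT A b xbar (fun y t => (Phi Q d xbar - νR - β) * t * t +
        (β⁻¹ * ∑ i ∈ J, lam i * -(A *ᵥ y) i) * (∑ i ∈ I, (K * M i) * -(A *ᵥ y) i) +
        ∑ i ∈ I, (K * -(A *ᵥ y) i) * (M i * t - -(A *ᵥ y) i)) :=
      (hδ.add (((IsL.sum J _ hactJ).smul (inv_nonneg.2 hβ0)).mul (IsL.sum I _ hactI))).add
        (IsT.sum I _ fun i hi => ((hact i hi).smul hK).mul (hM i hi).2)
    refine reduction Q hQ d A b xbar νR β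
      (β⁻¹ • (-(Q *ᵥ xbar + d) + ∑ i ∈ I, (-(K * M i)) • A i)) _ hT fun y t => ?_
    have hcy : (β⁻¹ • (-(Q *ᵥ xbar + d) + ∑ i ∈ I, (-(K * M i)) • A i)) ⬝ᵥ y
        = β⁻¹ * (-((Q *ᵥ xbar + d) ⬝ᵥ y) + ∑ i ∈ I, (K * M i) * -(A *ᵥ y) i) := by
      rw [smul_dotProduct, smul_eq_mul, add_dotProduct, neg_dotProduct, sum_dotProduct]
      congr 2
      refine Finset.sum_congr rfl fun j _ => ?_
      rw [smul_dotProduct, smul_eq_mul]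
      change -(K * M j) * (A *ᵥ y) j = _
      ring
    have hlast : ∑ i ∈ I, (K * -(A *ᵥ y) i) * (M i * t - -(A *ᵥ y) i)
        = t * (∑ i ∈ I, (K * M i) * -(A *ᵥ y) i) - K * ∑ i ∈ I, (A *ᵥ y) i ^ 2 := by
      rw [Finset.mul_sum, Finset.mul_sum, ← Finset.sum_sub_distrib]
      exact Finset.sum_congr rfl fun i hi => by ring
    have h0 := hfin y
    rw [hcy, hlast, ← hg lam hl he y]
    generalize (Q *ᵥ xbar + d) ⬝ᵥ y = G at *
    generalize ∑ i ∈ I, (K * M i) * -(A *ᵥ y) i = R at *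
    refine h0.trans (le_of_eq ?_)
    field_simp
    ring
end

section
/- Let Q be a symmetric n×n real matrix with at least one negative eigenvalue, d ∈ ℝⁿ, A ∈ ℝ^{m×n}, b ∈ ℝᵐ, and suppose F = {x : Ax ≤ b} is bounded. Let x̄ be a KKT point of the QP such that pᵀQp > 0 for every nonzero p with a_iᵀp = 0 for all i ∈ I_{x̄}. Let ν_R and β satisfy 0 < β < Φ(x̄) − ν_R. Then there exist a positive DEFINITE S ∈ 𝒮^{n+1}, an entrywise nonnegative T ∈ ℝ^{(m+1)×(m+1)} and c ∈ ℝⁿ such that [Q, d; dᵀ, −ν_R] = S + B₁ᵀ T B₁ + ½ u vᵀ + ½ v uᵀ, where B₁ = [−A, b; 0ᵀ, 1] ∈ ℝ^{(m+1)×(n+1)}, u = (Qx̄ + d; −x̄ᵀQx̄ − dᵀx̄ + β) and v = (−c; 1 + cᵀx̄). (This is the strict feasibility assertion of the cut-generating SDP.) -/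
open Matrix

open Matrix

/-- Finsler-type lemma for degree-two homogeneous continuous functions. -/
lemma finsler_aux {n : ℕ} (f h : (Fin n → ℝ) → ℝ) (hf : Continuous f) (hh : Continuous h)
    (hf2 : ∀ (r : ℝ) p, f (r • p) = r ^ 2 * f p) (hh2 : ∀ (r : ℝ) p, h (r • p) = r ^ 2 * h p)
    (h0 : ∀ p, 0 ≤ h p) (hpos : ∀ p, p ≠ 0 → h p = 0 → 0 < f p) :
    ∃ M : ℝ, 0 ≤ M ∧ ∀ p, p ≠ 0 → 0 < f p + M * h p := by
  obtain ⟨k, hk⟩ := (isCompact_sphere (0 : Fin n → ℝ) 1).elim_directed_cover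
    (fun k : ℕ => {p | 0 < f p + (k : ℝ) * h p})
    (fun k => isOpen_lt continuous_const (by fun_prop))
    (by
      intro p hp
      have hp0 : p ≠ 0 := by
        rintro rfl
        simp at hp
      simp only [Set.mem_iUnion, Set.mem_ofPred_eq]
      rcases (h0 p).eq_or_lt with hz | hz
      · exact ⟨0, by simpa using hpos p hp0 hz.symm⟩
      · obtain ⟨k, hk⟩ := exists_nat_gt (-f p / h p)
        refine ⟨k, ?_⟩
        rw [div_lt_iff₀ hz] at hk
        linarith)
    (by
      refine Monotone.directed_le (f := fun k : ℕ => {p | 0 < f p + (k : ℝ) * h p}) ?_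
      intro k l hkl p hp
      simp only [Set.mem_ofPred_eq] at hp ⊢
      have : (k : ℝ) ≤ l := by exact_mod_cast hkl
      nlinarith [mul_le_mul_of_nonneg_right this (h0 p)])
  refine ⟨k, by positivity, fun p hp => ?_⟩
  have hn : 0 < ‖p‖ := norm_pos_iff.mpr hp
  have := hk (show ‖p‖⁻¹ • p ∈ Metric.sphere (0 : Fin n → ℝ) 1 by
    simp [norm_smul, hn.ne'])
  simp only [Set.mem_ofPred_eq, hf2, hh2] at this
  have h3 : 0 < (‖p‖⁻¹) ^ 2 * (f p + k * h p) := by linarith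
  exact (pos_iff_pos_of_mul_pos h3).mp (by positivity)

/-- Stiemke's lemma (the direction needed here). -/
lemma stiemke_aux {n m : ℕ} (A : Matrix (Fin m) (Fin n) ℝ)
    (hA : ∀ p, A *ᵥ p ≤ 0 → p = 0) :
    ∃ μ : Fin m → ℝ, (∀ i, 0 < μ i) ∧ ∀ p, μ ⬝ᵥ (A *ᵥ p) = 0 := by
  have hAc : ∀ i, Continuous fun p : Fin n → ℝ => (A *ᵥ p) i := fun i =>
    (continuous_apply i).comp (Continuous.matrix_mulVec continuous_const continuous_id)
  let h : (Fin n → ℝ) → ℝ := fun p => ∑ i, max 0 ((A *ᵥ p) i)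
  have hhc : Continuous h := continuous_finsetSum _ fun i _ => continuous_const.max (hAc i)
  have hpos : ∀ p, p ≠ 0 → 0 < h p := by
    intro p hp
    by_contra hc
    apply hp
    apply hA
    intro i
    have h1 : h p = 0 := le_antisymm (not_lt.mp hc) (Finset.sum_nonneg fun i _ => le_max_left _ _)
    have h2 := (Finset.sum_eq_zero_iff_of_nonneg (fun i _ => le_max_left _ _)).mp h1 i
      (Finset.mem_univ i)
    have := le_max_right 0 ((A *ᵥ p) i)
    rw [h2] at this
    exact this
  have hδ : ∃ δ : ℝ, 0 < δ ∧ ∀ p, δ * ‖p‖ ≤ h p := by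
    rcases (Metric.sphere (0 : Fin n → ℝ) 1).eq_empty_or_nonempty with he | hne
    · refine ⟨1, one_pos, fun p => ?_⟩
      by_cases hp : p = 0
      · subst hp
        simpa using Finset.sum_nonneg fun i _ => le_max_left _ _
      · exfalso
        have : ‖p‖⁻¹ • p ∈ Metric.sphere (0 : Fin n → ℝ) 1 := by
          simp [norm_smul, hp]
        rw [he] at this
        exact this
    · obtain ⟨q, hq, hmin⟩ := (isCompact_sphere (0 : Fin n → ℝ) 1).exists_isMinOn hne
        hhc.continuousOn
      have hq0 : q ≠ 0 := by
        rintro rfl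
        simp at hq
      refine ⟨h q, hpos q hq0, fun p => ?_⟩
      by_cases hp : p = 0
      · subst hp
        simpa using Finset.sum_nonneg fun i _ => le_max_left _ _
      · have hn : 0 < ‖p‖ := norm_pos_iff.mpr hp
        have h1 : h q ≤ h (‖p‖⁻¹ • p) := hmin (by simp [norm_smul, hp])
        have h2 : h (‖p‖⁻¹ • p) = ‖p‖⁻¹ * h p := by
          simp only [h, Finset.mul_sum]
          refine Finset.sum_congr rfl fun i _ => ?_
          rw [mulVec_smul, Pi.smul_apply, smul_eq_mul, mul_max_of_nonneg _ _ (by positivity),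
            mul_zero]
        rw [h2, inv_mul_eq_div, le_div_iff₀ hn] at h1
        exact h1
  obtain ⟨δ, hδ0, hδ⟩ := hδ
  let f : (Fin n → ℝ) → ℝ := fun p => ∑ i, Real.exp ((A *ᵥ p) i)
  have hfc : Continuous f := continuous_finsetSum _ fun i _ => Real.continuous_exp.comp (hAc i)
  have hfh : ∀ p, δ * ‖p‖ ≤ f p := fun p => (hδ p).trans <| Finset.sum_le_sum fun i _ =>
    max_le (Real.exp_pos _).le (by linarith [Real.add_one_le_exp ((A *ᵥ p) i)])
  obtain ⟨q, hq⟩ := hfc.exists_forall_le (Filter.tendsto_atTop_mono hfh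
    ((tendsto_norm_cocompact_atTop (E := Fin n → ℝ)).const_mul_atTop hδ0))
  refine ⟨fun i => Real.exp ((A *ᵥ q) i), fun i => Real.exp_pos _, fun p => ?_⟩
  have hd : HasDerivAt (fun r : ℝ => f (q + r • p))
      (∑ i, Real.exp ((A *ᵥ q) i) * (A *ᵥ p) i) 0 := by
    simp only [f]
    refine HasDerivAt.fun_sum fun i _ => ?_
    simp only [mulVec_add, mulVec_smul, Pi.add_apply, Pi.smul_apply, smul_eq_mul]
    have h1 : HasDerivAt (fun r : ℝ => (A *ᵥ q) i + r * (A *ᵥ p) i) ((A *ᵥ p) i) 0 := by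
      simpa using ((hasDerivAt_id (0 : ℝ)).mul_const ((A *ᵥ p) i)).const_add ((A *ᵥ q) i)
    simpa using h1.exp
  have hm : IsLocalMin (fun r : ℝ => f (q + r • p)) 0 :=
    Filter.Eventually.of_forall fun r => by simpa using hq (q + r • p)
  simpa [dotProduct] using hm.hasDerivAt_eq_zero hd

lemma recession_aux {n m : ℕ} (A : Matrix (Fin m) (Fin n) ℝ) (b : Fin m → ℝ)
    (hbdd : Bornology.IsBounded {x : Fin n → ℝ | A *ᵥ x ≤ b})
    (x : Fin n → ℝ) (hx : A *ᵥ x ≤ b) (p : Fin n → ℝ) (hp : A *ᵥ p ≤ 0) : p = 0 := by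
  obtain ⟨C, hC⟩ := isBounded_iff_forall_norm_le.mp hbdd
  by_contra h
  have hn : 0 < ‖p‖ := norm_pos_iff.mpr h
  obtain ⟨k, hk⟩ := exists_nat_gt ((C + ‖x‖) / ‖p‖)
  rw [div_lt_iff₀ hn] at hk
  have h1 := hC (x + (k : ℝ) • p) (by
    intro i
    have h2 := hx i
    have h3 := hp i
    simp only [mulVec_add, mulVec_smul, Pi.add_apply, Pi.smul_apply, smul_eq_mul, Pi.zero_apply]
      at h2 h3 ⊢
    have : (k : ℝ) * (A *ᵥ p) i ≤ 0 := mul_nonpos_of_nonneg_of_nonpos (by positivity) h3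
    linarith)
  have h4 : ‖(k : ℝ) • p‖ ≤ ‖x + (k : ℝ) • p‖ + ‖x‖ := by
    have := norm_sub_le (x + (k : ℝ) • p) x
    simpa using this
  rw [norm_smul, Real.norm_natCast] at h4
  linarith

lemma vecMulVec_form_aux {ι : Type*} [Fintype ι] (u v z : ι → ℝ) :
    z ⬝ᵥ (vecMulVec u v *ᵥ z) = (u ⬝ᵥ z) * (v ⬝ᵥ z) := by
  rw [vecMulVec_mulVec, dotProduct_smul, dotProduct_comm z u]
  simp

lemma objMat_form_aux {n : ℕ} (Q : Matrix (Fin n) (Fin n) ℝ) (d : Fin n → ℝ) (ν : ℝ)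
    (x : Fin n → ℝ) (t : ℝ) :
    Sum.elim x (fun _ : Unit => t) ⬝ᵥ (objMat Q d ν *ᵥ Sum.elim x (fun _ => t)) =
      x ⬝ᵥ (Q *ᵥ x) + 2 * t * (d ⬝ᵥ x) - ν * t ^ 2 := by
  have h1 : objMat Q d ν *ᵥ Sum.elim x (fun _ => t) =
      Sum.elim (Q *ᵥ x + t • d) (fun _ => d ⬝ᵥ x - ν * t) := by
    ext i
    rcases i with i | i
    · simp [objMat, mulVec, dotProduct, mul_comm]
    · simp [objMat, mulVec, dotProduct]
      ring
  rw [h1, sumElim_dotProduct_sumElim, dotProduct_add, dotProduct_smul, dotProduct_comm x d]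
  simp [dotProduct]
  ring

lemma feasMat_mulVec_aux {n m : ℕ} (A : Matrix (Fin m) (Fin n) ℝ) (b : Fin m → ℝ)
    (x : Fin n → ℝ) (t : ℝ) :
    feasMat A b *ᵥ Sum.elim x (fun _ => t) = Sum.elim (t • b - A *ᵥ x) (fun _ => t) := by
  ext i
  rcases i with i | i
  · simp [feasMat, mulVec, dotProduct]
    ring
  · simp [feasMat, mulVec, dotProduct]

/-- Theorem `thm:STc` (b). Let `Q` be symmetric with at least one
negative eigenvalue, `F` bounded, `x̄` a KKT point with `Q` positive definite on the
null space of the active constraints, and `0 < β < Φ(x̄) − ν_R`. Then the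
cut-generating SDP is strictly feasible: there exist `S ≻ 0`, `T ≥ 0` entrywise,
and `c` with `[Q, d; dᵀ, −ν_R] = S + B₁ᵀ T B₁ + ½uvᵀ + ½vuᵀ`. -/
theorem cut_SDP_strictly_feasible {n m : ℕ}
    (Q : Matrix (Fin n) (Fin n) ℝ) (hQ : Q.IsSymm)
    (hneg : ∃ μ : ℝ, μ < 0 ∧ ∃ v : Fin n → ℝ, v ≠ 0 ∧ Q *ᵥ v = μ • v)
    (d : Fin n → ℝ) (A : Matrix (Fin m) (Fin n) ℝ) (b : Fin m → ℝ)
    (hbdd : Bornology.IsBounded {x : Fin n → ℝ | A *ᵥ x ≤ b})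
    (xbar : Fin n → ℝ) (hfeas : A *ᵥ xbar ≤ b)
    (hKKT : ∃ lam : Fin m → ℝ, 0 ≤ lam ∧
      Q *ᵥ xbar + d = -(Aᵀ *ᵥ lam) ∧ (A *ᵥ xbar - b) ⬝ᵥ lam = 0)
    (hpd : ∀ p : Fin n → ℝ, p ≠ 0 →
      (∀ i : Fin m, (A *ᵥ xbar) i = b i → (A *ᵥ p) i = 0) → 0 < p ⬝ᵥ (Q *ᵥ p))
    (νR β : ℝ) (hβ0 : 0 < β) (hβ1 : β < Phi Q d xbar - νR) :
    ∃ (S : Matrix (Fin n ⊕ Unit) (Fin n ⊕ Unit) ℝ)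
      (T : Matrix (Fin m ⊕ Unit) (Fin m ⊕ Unit) ℝ) (c : Fin n → ℝ),
      S.PosDef ∧ (∀ i j, 0 ≤ T i j) ∧
      objMat Q d νR =
        S + (feasMat A b)ᵀ * T * feasMat A b +
          (1 / 2 : ℝ) • (vecMulVec (uVec Q d xbar β) (vVec c xbar)) +
          (1 / 2 : ℝ) • (vecMulVec (vVec c xbar) (uVec Q d xbar β)) := by
  obtain ⟨lam, hlam0, hlam, hcomp⟩ := hKKT
  obtain ⟨μ, hμ, hμA⟩ := stiemke_aux A (recession_aux A b hbdd xbar hfeas)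
  classical
  set s : Fin m → ℝ := b - A *ᵥ xbar with hs
  set g : Fin n → ℝ := Q *ᵥ xbar + d with hg
  have hs0 : ∀ i, 0 ≤ s i := fun i => sub_nonneg.mpr (hfeas i)
  have hls : ∀ i, lam i * s i = 0 := by
    have h1 : ∑ i, lam i * s i = 0 := by
      have : ∑ i, lam i * s i = -((A *ᵥ xbar - b) ⬝ᵥ lam) := by
        simp only [dotProduct, ← Finset.sum_neg_distrib]
        refine Finset.sum_congr rfl fun i _ => ?_
        simp [hs]
        ring
      rw [this, hcomp, neg_zero]
    intro i
    exact (Finset.sum_eq_zero_iff_of_nonneg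
      (fun i _ => mul_nonneg (hlam0 i) (hs0 i))).mp h1 i (Finset.mem_univ i)
  have hgA : ∀ p, g ⬝ᵥ p = -(lam ⬝ᵥ (A *ᵥ p)) := by
    intro p
    rw [hlam, neg_dotProduct, mulVec_transpose, dotProduct_mulVec]
  let χ : Fin m → ℝ := fun i => if s i = 0 then 1 else 0
  let a : Fin m → ℝ := fun i => if s i = 0 then μ i else 0
  let e : Fin m → ℝ := fun i => if s i = 0 then 0 else μ i
  have ha0 : ∀ i, 0 ≤ a i := fun i => by
    simp only [a]; split_ifs <;> [exact (hμ i).le; rfl]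
  have he0 : ∀ i, 0 ≤ e i := fun i => by
    simp only [e]; split_ifs <;> [rfl; exact (hμ i).le]
  have hae : a + e = μ := by
    ext i; simp only [a, e, Pi.add_apply]; split_ifs <;> simp
  have has : a ⬝ᵥ s = 0 := Finset.sum_eq_zero fun i _ => by
    simp only [a]; split_ifs with h <;> simp [h]
  have hlams : lam ⬝ᵥ s = 0 := Finset.sum_eq_zero fun i _ => hls i
  have heA : ∀ p, e ⬝ᵥ (A *ᵥ p) = -(a ⬝ᵥ (A *ᵥ p)) := fun p => by
    have := hμA p
    rw [← hae, add_dotProduct] at this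
    linarith
  -- Finsler
  have hAc : ∀ i, Continuous fun p : Fin n → ℝ => (A *ᵥ p) i := fun i =>
    (continuous_apply i).comp (Continuous.matrix_mulVec continuous_const continuous_id)
  have hχ0 : ∀ i, 0 ≤ χ i := fun i => by simp only [χ]; split_ifs <;> simp
  obtain ⟨M, hM0, hM⟩ := finsler_aux
    (fun p : Fin n → ℝ => p ⬝ᵥ (Q *ᵥ p) - (g ⬝ᵥ p) ^ 2 / β)
    (fun p => ∑ i, χ i * ((A *ᵥ p) i) ^ 2)
    (by
      have h1 : Continuous fun p : Fin n → ℝ => p ⬝ᵥ (Q *ᵥ p) :=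
        continuous_id.dotProduct (Continuous.matrix_mulVec continuous_const continuous_id)
      have h2 : Continuous fun p : Fin n → ℝ => g ⬝ᵥ p :=
        continuous_const.dotProduct continuous_id
      fun_prop)
    (continuous_finsetSum _ fun i _ => continuous_const.mul ((hAc i).pow 2))
    (fun r p => by
      simp only [mulVec_smul, dotProduct_smul, smul_dotProduct, smul_eq_mul]
      ring)
    (fun r p => by
      simp only [mulVec_smul, Pi.smul_apply, smul_eq_mul, Finset.mul_sum]
      exact Finset.sum_congr rfl fun i _ => by ring)
    (fun p => Finset.sum_nonneg fun i _ => mul_nonneg (hχ0 i) (sq_nonneg _))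
    (by
      intro p hp h0
      have h1 : ∀ i, s i = 0 → (A *ᵥ p) i = 0 := by
        intro i hi
        have := (Finset.sum_eq_zero_iff_of_nonneg
          (fun i _ => mul_nonneg (hχ0 i) (sq_nonneg _))).mp h0 i (Finset.mem_univ i)
        simpa [χ, hi] using this
      have h2 : g ⬝ᵥ p = 0 := by
        rw [hgA, neg_eq_zero]
        refine Finset.sum_eq_zero fun i _ => ?_
        rcases mul_eq_zero.mp (hls i) with h | h
        · rw [h, zero_mul]
        · rw [h1 i h, mul_zero]
      have h3 := hpd p hp fun i hi => h1 i (by simp [hs, hi])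
      simpa [h2] using h3)
  -- the constant K
  obtain ⟨K, hK0, hK⟩ : ∃ K : ℝ, 0 ≤ K ∧ ∀ i, M ≤ 2 * K * (μ i) ^ 2 := by
    refine ⟨∑ i, M / (μ i) ^ 2, Finset.sum_nonneg fun i _ => by positivity, fun i => ?_⟩
    have h1 : M / (μ i) ^ 2 ≤ ∑ i, M / (μ i) ^ 2 :=
      Finset.single_le_sum (f := fun i => M / (μ i) ^ 2) (fun i _ => by positivity)
        (Finset.mem_univ i)
    have h2 : 0 < (μ i) ^ 2 := pow_pos (hμ i) 2
    rw [div_le_iff₀ h2] at h1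
    linarith
  have hσ0 : 0 ≤ e ⬝ᵥ s := Finset.sum_nonneg fun i _ => mul_nonneg (he0 i) (hs0 i)
  set σ : ℝ := e ⬝ᵥ s with hσ
  obtain ⟨κ, hκ⟩ : ∃ κ : ℝ, κ = K * σ / β := ⟨_, rfl⟩
  have hκ0 : 0 ≤ κ := by rw [hκ]; positivity
  let T0 : Matrix (Fin m) (Fin m) ℝ :=
    ((2 * K) • vecMulVec a a - M • diagonal χ) + K • (vecMulVec a e + vecMulVec e a) +
      κ • (vecMulVec lam a + vecMulVec a lam)
  have hT0 : ∀ i j, 0 ≤ T0 i j := by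
    intro i j
    have h1 : 0 ≤ ((2 * K) • vecMulVec a a - M • diagonal χ) i j := by
      simp only [Matrix.sub_apply, Matrix.smul_apply, vecMulVec_apply, smul_eq_mul]
      by_cases hij : i = j
      · subst hij
        rw [diagonal_apply_eq]
        simp only [a, χ]
        split_ifs
        · linarith [hK i]
        · simp
      · rw [diagonal_apply_ne _ hij]
        have := mul_nonneg (ha0 i) (ha0 j)
        simp only [mul_zero, sub_zero]
        positivity
    have h2 : 0 ≤ (K • (vecMulVec a e + vecMulVec e a)) i j := by
      simp only [Matrix.add_apply, Matrix.smul_apply, vecMulVec_apply, smul_eq_mul]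
      exact mul_nonneg hK0 (add_nonneg (mul_nonneg (ha0 i) (he0 j)) (mul_nonneg (he0 i) (ha0 j)))
    have h3 : 0 ≤ (κ • (vecMulVec lam a + vecMulVec a lam)) i j := by
      simp only [Matrix.add_apply, Matrix.smul_apply, vecMulVec_apply, smul_eq_mul]
      exact mul_nonneg hκ0
        (add_nonneg (mul_nonneg (hlam0 i) (ha0 j)) (mul_nonneg (ha0 i) (hlam0 j)))
    exact add_nonneg (add_nonneg h1 h2) h3
  have hT0s : T0ᵀ = T0 := by
    simp only [T0, transpose_add, transpose_sub, transpose_smul, transpose_vecMulVec,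
      diagonal_transpose]
    rw [add_comm (vecMulVec e a), add_comm (vecMulVec a lam)]
  have hT0f : ∀ y, y ⬝ᵥ (T0 *ᵥ y) = 2 * K * (a ⬝ᵥ y) ^ 2 - M * ∑ i, χ i * y i ^ 2
      + 2 * K * (a ⬝ᵥ y) * (e ⬝ᵥ y) + 2 * κ * (lam ⬝ᵥ y) * (a ⬝ᵥ y) := by
    intro y
    have hdiag : y ⬝ᵥ (diagonal χ *ᵥ y) = ∑ i, χ i * y i ^ 2 := by
      refine Finset.sum_congr rfl fun i _ => ?_
      rw [mulVec_diagonal]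
      ring
    simp only [T0, add_mulVec, sub_mulVec, smul_mulVec, dotProduct_add, dotProduct_sub,
      dotProduct_smul, vecMulVec_form_aux, smul_eq_mul, hdiag]
    ring
  let T : Matrix (Fin m ⊕ Unit) (Fin m ⊕ Unit) ℝ := fromBlocks T0 0 0 0
  have hTs : Tᵀ = T := by
    simp only [T, fromBlocks_transpose, hT0s, transpose_zero]
  let c : Fin n → ℝ := (-(1 / β)) • (g + (2 * K * σ) • (a ᵥ* A))
  have hc : ∀ p, c ⬝ᵥ p = -(g ⬝ᵥ p + 2 * K * σ * (a ⬝ᵥ (A *ᵥ p))) / β := by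
    intro p
    simp only [c, smul_dotProduct, add_dotProduct, smul_eq_mul, dotProduct_mulVec]
    ring
  set u := uVec Q d xbar β with hu
  set v := vVec c xbar with hv
  have hobjs : (objMat Q d νR)ᵀ = objMat Q d νR := by
    ext i j
    rcases i with i | i <;> rcases j with j | j <;> simp [objMat, hQ.apply]
  refine ⟨objMat Q d νR - (feasMat A b)ᵀ * T * feasMat A b - (1 / 2 : ℝ) • vecMulVec u v
    - (1 / 2 : ℝ) • vecMulVec v u, T, c, ?_, ?_, ?_⟩
  · refine PosDef.of_dotProduct_mulVec_pos ?_ ?_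
    · rw [IsHermitian, conjTranspose_eq_transpose_of_trivial]
      simp only [transpose_sub, transpose_smul, transpose_mul, transpose_transpose,
        transpose_vecMulVec, hTs, hobjs, Matrix.mul_assoc]
      abel
    · intro z hz
      obtain ⟨x, t, rfl⟩ : ∃ (x : Fin n → ℝ) (t : ℝ), z = Sum.elim x (fun _ => t) :=
        ⟨fun i => z (Sum.inl i), z (Sum.inr ()), by ext i; rcases i with i | i <;> rfl⟩
      obtain ⟨p, rfl⟩ : ∃ p, x = p + t • xbar := ⟨x - t • xbar, by simp⟩
      have hy : t • b - A *ᵥ (p + t • xbar) = t • s - A *ᵥ p := by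
        rw [mulVec_add, mulVec_smul, hs, smul_sub]
        abel
      have hTf : Sum.elim (p + t • xbar) (fun _ : Unit => t) ⬝ᵥ
          (((feasMat A b)ᵀ * T * feasMat A b) *ᵥ Sum.elim (p + t • xbar) (fun _ => t)) =
          (t • s - A *ᵥ p) ⬝ᵥ (T0 *ᵥ (t • s - A *ᵥ p)) := by
        rw [← mulVec_mulVec, ← mulVec_mulVec, dotProduct_mulVec, vecMul_transpose,
          feasMat_mulVec_aux, hy, fromBlocks_mulVec, sumElim_dotProduct_sumElim]
        have h0 : (t • s - A *ᵥ p ⊕ᵥ fun _ : Unit => t) ∘ Sum.inl = t • s - A *ᵥ p := rfl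
        rw [h0]
        simp only [zero_mulVec, add_zero, dotProduct_zero]
      have huz : u ⬝ᵥ Sum.elim (p + t • xbar) (fun _ : Unit => t) = g ⬝ᵥ p + β * t := by
        rw [hu, uVec, sumElim_dotProduct_sumElim, ← hg, dotProduct_add, dotProduct_smul]
        have : g ⬝ᵥ xbar = xbar ⬝ᵥ (Q *ᵥ xbar) + d ⬝ᵥ xbar := by
          rw [hg, add_dotProduct, dotProduct_comm (Q *ᵥ xbar)]
        rw [this]
        simp [dotProduct]
        ring
      have hvz : v ⬝ᵥ Sum.elim (p + t • xbar) (fun _ : Unit => t) = t - c ⬝ᵥ p := by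
        rw [hv, vVec, sumElim_dotProduct_sumElim, dotProduct_add, dotProduct_smul,
          neg_dotProduct, neg_dotProduct]
        have : (fun _ : Unit => 1 + c ⬝ᵥ xbar) ⬝ᵥ (fun _ : Unit => t) = (1 + c ⬝ᵥ xbar) * t := by
          rw [dotProduct]; simp
        rw [this, smul_eq_mul]
        ring
      have hsum : ∑ i, χ i * (t • s - A *ᵥ p) i ^ 2 = ∑ i, χ i * ((A *ᵥ p) i) ^ 2 := by
        refine Finset.sum_congr rfl fun i _ => ?_
        simp only [χ]
        split_ifs with h
        · simp [h]
        · simp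
      have hQc : xbar ⬝ᵥ (Q *ᵥ p) = p ⬝ᵥ (Q *ᵥ xbar) := by
        rw [dotProduct_mulVec, ← mulVec_transpose, hQ.eq, dotProduct_comm]
      have hobj : (p + t • xbar) ⬝ᵥ (Q *ᵥ (p + t • xbar)) + 2 * t * (d ⬝ᵥ (p + t • xbar))
          - νR * t ^ 2 = p ⬝ᵥ (Q *ᵥ p) + 2 * t * (g ⬝ᵥ p) + (Phi Q d xbar - νR) * t ^ 2 := by
        simp only [mulVec_add, mulVec_smul, dotProduct_add, add_dotProduct, smul_dotProduct,
          dotProduct_smul, smul_eq_mul, hQc, hg, Phi, dotProduct_comm (Q *ᵥ xbar) p]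
        ring
      have key : star (Sum.elim (p + t • xbar) (fun _ : Unit => t)) ⬝ᵥ
          ((objMat Q d νR - (feasMat A b)ᵀ * T * feasMat A b - (1 / 2 : ℝ) • vecMulVec u v
            - (1 / 2 : ℝ) • vecMulVec v u) *ᵥ Sum.elim (p + t • xbar) (fun _ => t)) =
          (p ⬝ᵥ (Q *ᵥ p) - (g ⬝ᵥ p) ^ 2 / β + M * ∑ i, χ i * ((A *ᵥ p) i) ^ 2)
            + (Phi Q d xbar - νR - β) * t ^ 2 := by
        rw [star_trivial]
        simp only [sub_mulVec, smul_mulVec, dotProduct_sub, dotProduct_smul, vecMulVec_form_aux,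
          smul_eq_mul, hTf, huz, hvz, objMat_form_aux, hobj, hT0f, hsum]
        simp only [dotProduct_sub, dotProduct_smul, has, hlams, ← hσ, heA, smul_eq_mul, hc]
        have hl : lam ⬝ᵥ (A *ᵥ p) = -(g ⬝ᵥ p) := by rw [hgA, neg_neg]
        rw [hl, hκ]
        field_simp
        ring
      rw [key]
      by_cases hp : p = 0
      · subst hp
        have ht : t ≠ 0 := by
          rintro rfl
          apply hz
          ext i
          rcases i with i | i <;> simp
        have h1 : 0 < (Phi Q d xbar - νR - β) * t ^ 2 :=
          mul_pos (by linarith) (by positivity)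
        simpa using h1
      · have h1 := hM p hp
        have h2 : 0 ≤ (Phi Q d xbar - νR - β) * t ^ 2 :=
          mul_nonneg (by linarith) (by positivity)
        linarith
  · intro i j
    rcases i with i | i <;> rcases j with j | j <;> simp [T, hT0]
  · abel
end
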